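/- arXiv:2006.07704 — 3 statements merged into one kernel-verified Lean document; each statement's English description precedes it below -/
import Mathlib

section
/- For all integers n ≥ 0 and k ≥ 1, one has (−1)^{k−1} ( Σ_{j=0}^{2k−1} (−1)^{T_j} Q(n − 2G_j) − χ(n) ) ≥ 0, where χ(n) = 1 if n is a triangular number (n = T_m for some integer m ≥ 0) and χ(n) = 0 otherwise; moreover the inequality is strict if and only if n ≥ 2G_{2k}. -/
/-- The `n`-th triangular number `T n = n(n+1)/2`. -/
def T (n : ℕ) : ℕ := n * (n + 1) / 2

/-- The `n`-th generalized pentagonal number `G n = T n - T ⌊n/2⌋`. -/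
def G (n : ℕ) : ℕ := T n - T (n / 2)

/-- The number of partitions of `n` into distinct parts, vanishing on negative integers. -/
def Q (n : ℤ) : ℤ :=
  if 0 ≤ n then ((Nat.Partition.distincts n.toNat).card : ℤ) else 0

open Classical in
/-- `χ(n) = 1` if `n` is a triangular number, `0` otherwise. -/
noncomputable def chi (n : ℕ) : ℤ := if ∃ m, n = T m then 1 else 0

open PowerSeries

section Pentagonal

variable {R : Type*} [CommRing R]

/-- The finite products whose sum over `n` is the remainder of the truncated pentagonal series. -/
def remainderTerm (x : R) (k n : ℕ) : R :=
  x ^ ((k + 1) * n) * ∏ i ∈ Finset.range (n + 1), (1 - x ^ (k + i + 1))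

/-- An antidifference in `n` of
`remainderTerm x k n + x ^ (3 * k + 5) * remainderTerm x (k + 1) n`. -/
def remainderPrimitive (x : R) (k n : ℕ) : R :=
  x ^ ((k + 1) * n) * (x ^ (2 * k + n + 3) - 1) * ∏ i ∈ Finset.range n, (1 - x ^ (k + i + 2))

theorem remainderPrimitive_sub (x : R) (k n : ℕ) :
    remainderTerm x k n + x ^ (3 * k + 5) * remainderTerm x (k + 1) n =
      remainderPrimitive x k (n + 1) - remainderPrimitive x k n := by
  simp_rw [remainderPrimitive, Finset.prod_range_succ, remainderTerm]
  rw [Finset.prod_range_succ', Finset.prod_range_succ]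
  ring_nf

theorem sum_remainderTerm (x : R) (k L : ℕ) :
    ∑ n ∈ Finset.range L, remainderTerm x k n =
      1 - x ^ (2 * k + 3) - x ^ (3 * k + 5) * ∑ n ∈ Finset.range L, remainderTerm x (k + 1) n +
        remainderPrimitive x k L := by
  have h := Finset.sum_range_sub (remainderPrimitive x k) L
  simp_rw [← remainderPrimitive_sub, Finset.sum_add_distrib, ← Finset.mul_sum] at h
  have h0 : remainderPrimitive x k 0 = x ^ (2 * k + 3) - 1 := by simp [remainderPrimitive]
  rw [h0] at h
  linear_combination h

theorem prod_one_sub_pow_succ (x : R) (L : ℕ) :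
    ∏ i ∈ Finset.range (L + 1), (1 - x ^ (i + 1)) =
      1 - x - x ^ 2 * ∑ n ∈ Finset.range L, remainderTerm x 0 n := by
  induction L with
  | zero => simp
  | succ L ih =>
    rw [Finset.prod_range_succ, Finset.sum_range_succ, mul_add, ← sub_sub, ← ih, remainderTerm]
    simp only [zero_add]
    ring

theorem T_two_mul (k : ℕ) : T (2 * k) = k * (2 * k + 1) := by
  rw [T, mul_assoc, Nat.mul_div_cancel_left _ two_pos]

theorem T_two_mul_add_one (k : ℕ) : T (2 * k + 1) = (2 * k + 1) * (k + 1) := by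
  rw [T, show (2 * k + 1) * (2 * k + 1 + 1) = 2 * ((2 * k + 1) * (k + 1)) by ring,
    Nat.mul_div_cancel_left _ two_pos]

theorem two_mul_T (k : ℕ) : 2 * T k = k * (k + 1) :=
  Nat.mul_div_cancel' (Nat.even_mul_succ_self k).two_dvd

theorem two_mul_G_two_mul (k : ℕ) : 2 * G (2 * k) = k * (3 * k + 1) := by
  have h := two_mul_T k
  rw [G, T_two_mul, Nat.mul_div_cancel_left _ two_pos, Nat.mul_sub, h]
  apply Nat.sub_eq_of_eq_add
  ring

theorem G_two_mul_add_one (k : ℕ) : G (2 * k + 1) = G (2 * k) + (2 * k + 1) := by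
  have h := two_mul_T k
  have h' := two_mul_G_two_mul k
  have hd : (2 * k + 1) / 2 = k := by omega
  have : 2 * G (2 * k + 1) = (k + 1) * (3 * k + 2) := by
    rw [G, T_two_mul_add_one, hd, Nat.mul_sub, h]
    apply Nat.sub_eq_of_eq_add
    ring
  nlinarith

theorem G_two_mul_succ (k : ℕ) : G (2 * (k + 1)) = G (2 * k) + (3 * k + 2) := by
  have h := two_mul_G_two_mul k
  have h' := two_mul_G_two_mul (k + 1)
  nlinarith

theorem neg_one_pow_T_two_mul (k : ℕ) : (-1 : R) ^ T (2 * k) = (-1) ^ k := by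
  rw [T_two_mul, mul_comm, pow_mul, Odd.neg_one_pow ⟨k, rfl⟩]

theorem neg_one_pow_T_two_mul_add_one (k : ℕ) : (-1 : R) ^ T (2 * k + 1) = -(-1) ^ k := by
  rw [T_two_mul_add_one, pow_mul, Odd.neg_one_pow ⟨k, rfl⟩, pow_succ]
  ring

theorem sum_range_two_mul_succ_pentagonal (x : R) (k : ℕ) :
    ∑ j ∈ Finset.range (2 * (k + 1)), (-1) ^ T j * x ^ G j =
      ∑ j ∈ Finset.range (2 * k), (-1) ^ T j * x ^ G j +
        (-1) ^ k * x ^ G (2 * k) * (1 - x ^ (2 * k + 1)) := by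
  rw [show 2 * (k + 1) = 2 * k + 1 + 1 by ring, Finset.sum_range_succ, Finset.sum_range_succ,
    neg_one_pow_T_two_mul, neg_one_pow_T_two_mul_add_one, G_two_mul_add_one]
  ring

/-- The truncated pentagonal number theorem with explicit remainder, modulo `x ^ L`. -/
theorem pow_dvd_prod_sub_truncated_pentagonal (x : R) (L k : ℕ) :
    x ^ L ∣ ∏ i ∈ Finset.range (L + 1), (1 - x ^ (i + 1)) -
      (∑ j ∈ Finset.range (2 * (k + 1)), (-1) ^ T j * x ^ G j +
        (-1) ^ (k + 1) * x ^ G (2 * (k + 1)) * ∑ n ∈ Finset.range L, remainderTerm x k n) := by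
  induction k with
  | zero =>
    rw [prod_one_sub_pow_succ, sum_range_two_mul_succ_pentagonal, G_two_mul_succ]
    have h0 : G (2 * 0) = 0 := rfl
    simp only [h0]
    convert dvd_zero (x ^ L) using 1
    simp
    ring
  | succ k ih =>
    have hb : x ^ L ∣ remainderPrimitive x k L := by
      rw [remainderPrimitive, mul_assoc]
      exact (pow_dvd_pow x (Nat.le_mul_of_pos_left L k.succ_pos)).mul_right _
    rw [sum_remainderTerm] at ih
    rw [sum_range_two_mul_succ_pentagonal, G_two_mul_succ (k + 1)]
    convert ih.add (hb.mul_left ((-1) ^ (k + 1) * x ^ G (2 * (k + 1)))) using 1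
    ring

end Pentagonal

section Gauss

variable {R : Type*} [CommRing R]

/-- The product `∏_{s < r ≤ n} (1 - q ^ (2r)) ∏_{r ≤ s} (1 - q ^ (2r - 1))`. -/
def mixedProd (q : R) (n s : ℕ) : R :=
  (∏ r ∈ Finset.Ico s n, (1 - q ^ (2 * (r + 1)))) * ∏ r ∈ Finset.range s, (1 - q ^ (2 * r + 1))

theorem mixedProd_succ_left (q : R) {n s : ℕ} (h : s ≤ n) :
    mixedProd q (n + 1) s = (1 - q ^ (2 * (n + 1))) * mixedProd q n s := by
  rw [mixedProd, Finset.prod_Ico_succ_top h, mixedProd]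
  ring

theorem mixedProd_succ_right (q : R) {n s : ℕ} (h : s < n) :
    (1 - q ^ (2 * (s + 1))) * mixedProd q n (s + 1) = (1 - q ^ (2 * s + 1)) * mixedProd q n s := by
  rw [mixedProd, mixedProd, Finset.prod_range_succ, Finset.prod_eq_prod_Ico_succ_bot h]
  ring

theorem mixedProd_self (q : R) (n : ℕ) :
    mixedProd q n n = ∏ r ∈ Finset.range n, (1 - q ^ (2 * r + 1)) := by
  simp [mixedProd]

theorem sum_mixedProd_sub (q : R) (n m : ℕ) (h : m ≤ n) :
    ∑ s ∈ Finset.range m, (q ^ (s * (2 * n + 3)) * mixedProd q (n + 1) s -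
      (1 - q ^ (2 * n + 1)) * (q ^ (s * (2 * n + 1)) * mixedProd q n s)) =
      q ^ (m * (2 * n + 1)) * ((1 - q ^ (2 * m)) * mixedProd q n m) := by
  induction m with
  | zero => simp
  | succ m ih =>
    rw [Finset.sum_range_succ, ih (by omega), mixedProd_succ_right q h,
      mixedProd_succ_left q (by omega)]
    ring

/-- A finite form, due to Shanks, of the Gauss identity for triangular numbers. -/
theorem sum_mixedProd (q : R) (n : ℕ) :
    ∑ s ∈ Finset.range (n + 1), q ^ (s * (2 * n + 1)) * mixedProd q n s =
      (∏ r ∈ Finset.range n, (1 - q ^ (2 * r + 1))) * ∑ s ∈ Finset.range (2 * n + 1), q ^ T s := by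
  induction n with
  | zero => simp [mixedProd, T]
  | succ n ih =>
    have h := sum_mixedProd_sub q n n le_rfl
    rw [Finset.sum_sub_distrib, ← Finset.mul_sum] at h
    rw [Finset.sum_range_succ] at ih
    rw [Finset.sum_range_succ, Finset.sum_range_succ, mixedProd_succ_left q le_rfl,
      mixedProd_self q n, mixedProd_self,
      show 2 * (n + 1) + 1 = 2 * n + 1 + 1 + 1 by ring, Finset.sum_range_succ _ (2 * n + 1 + 1),
      Finset.sum_range_succ _ (2 * n + 1), T_two_mul_add_one, show 2 * n + 1 + 1 = 2 * (n + 1) by ring,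
      T_two_mul, Finset.prod_range_succ]
    rw [mixedProd_self] at h ih
    linear_combination h + (1 - q ^ (2 * n + 1)) * ih

theorem pow_dvd_prod_even_sub (q : R) (n : ℕ) :
    q ^ (2 * n + 1) ∣ ∏ r ∈ Finset.range n, (1 - q ^ (2 * (r + 1))) -
      (∏ r ∈ Finset.range n, (1 - q ^ (2 * r + 1))) * ∑ s ∈ Finset.range (2 * n + 1), q ^ T s := by
  rw [← sum_mixedProd, Finset.sum_range_succ']
  have h : q ^ (2 * n + 1) ∣ ∑ s ∈ Finset.range n,
      q ^ ((s + 1) * (2 * n + 1)) * mixedProd q n (s + 1) :=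
    Finset.dvd_sum fun s _ =>
      (pow_dvd_pow q (Nat.le_mul_of_pos_left _ s.succ_pos)).mul_right _
  convert h.neg_right using 1
  simp [mixedProd]

theorem pow_dvd_prod_one_sub_pow_sub_one (q : R) (m : ℕ) (s : Finset ℕ) (f : ℕ → ℕ)
    (h : ∀ i ∈ s, m ≤ f i) : q ^ m ∣ ∏ i ∈ s, (1 - q ^ f i) - 1 := by
  induction s using Finset.cons_induction with
  | empty => simp
  | cons a s ha ih =>
    rw [Finset.prod_cons]
    have h1 := ih fun i hi => h i (Finset.mem_cons_of_mem hi)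
    have h2 : q ^ m ∣ q ^ f a := pow_dvd_pow q (h a (Finset.mem_cons_self a s))
    convert h1.sub (h2.mul_right (∏ i ∈ s, (1 - q ^ f i))) using 1
    ring

theorem prod_range_two_mul (f : ℕ → R) (n : ℕ) :
    ∏ i ∈ Finset.range (2 * n), f i =
      (∏ i ∈ Finset.range n, f (2 * i)) * ∏ i ∈ Finset.range n, f (2 * i + 1) := by
  induction n with
  | zero => simp
  | succ n ih =>
    rw [show 2 * (n + 1) = 2 * n + 1 + 1 by ring, Finset.prod_range_succ, Finset.prod_range_succ,
      ih, Finset.prod_range_succ, Finset.prod_range_succ]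
    ring

end Gauss

section GeneratingFunction

/-- The generating function of the partitions into distinct parts. -/
noncomputable def distinctSeries : ℤ⟦X⟧ := .mk fun n => Q n

theorem one_sub_X_pow_ne_zero (m : ℕ) : (1 - X ^ (m + 1) : ℤ⟦X⟧) ≠ 0 := by
  intro h
  simpa using congrArg (coeff 0) h

open WithPiTopology Filter in
theorem X_pow_dvd_distinctSeries_sub (N : ℕ) :
    ∃ M₀, ∀ M, M₀ ≤ M →
      X ^ N ∣ distinctSeries - ∏ i ∈ Finset.range M, (1 + X ^ (i + 1) : ℤ⟦X⟧) := by
  have h := Nat.Partition.hasProd_powerSeriesMk_card_countRestricted ℤ (m := 2) Nat.two_pos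
  have hD : (PowerSeries.mk fun n ↦ ((Nat.Partition.countRestricted n 2).card : ℤ)) =
      distinctSeries := by
    ext n
    simp [distinctSeries, Q, Nat.Partition.countRestricted_two]
  rw [hD] at h
  have h2 := (WithPiTopology.tendsto_iff_coeff_tendsto ..).1 h.tendsto_prod_nat
  have h3 : ∀ᶠ M in atTop, ∀ d ∈ Finset.range N,
      coeff d (∏ i ∈ Finset.range M, (1 + X ^ (i + 1) : ℤ⟦X⟧)) = coeff d distinctSeries := by
    rw [Filter.eventually_all_finset]
    intro d _
    have := h2 d
    rw [nhds_discrete, tendsto_pure] at this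
    simpa only [Finset.sum_range_succ, Finset.sum_range_zero, mul_zero, mul_one, pow_zero,
      zero_add] using this
  obtain ⟨M₀, hM⟩ := eventually_atTop.1 h3
  refine ⟨M₀, fun M hMM => X_pow_dvd_iff.2 fun d hd => ?_⟩
  rw [map_sub, hM M hMM d (Finset.mem_range.2 hd), sub_self]

theorem X_pow_dvd_prod_mul_prod_odd_sub_one (n : ℕ) :
    (X : ℤ⟦X⟧) ^ (2 * n + 1) ∣ (∏ i ∈ Finset.range (2 * n), (1 + X ^ (i + 1))) *
      (∏ r ∈ Finset.range n, (1 - X ^ (2 * r + 1))) - 1 := by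
  have h : (∏ i ∈ Finset.range (2 * n), (1 + X ^ (i + 1) : ℤ⟦X⟧)) *
      (∏ r ∈ Finset.range n, (1 - X ^ (2 * r + 1))) =
      ∏ r ∈ Finset.Ico n (2 * n), (1 - X ^ (2 * (r + 1))) := by
    have hne : ∏ r ∈ Finset.range n, (1 - X ^ (2 * (r + 1)) : ℤ⟦X⟧) ≠ 0 :=
      Finset.prod_ne_zero_iff.2 fun r _ => one_sub_X_pow_ne_zero (2 * r + 1)
    apply mul_left_cancel₀ hne
    rw [Finset.prod_range_mul_prod_Ico _ (by omega : n ≤ 2 * n)]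
    have h1 := prod_range_two_mul (fun i => (1 - X ^ (i + 1) : ℤ⟦X⟧)) n
    have h2 : ∏ r ∈ Finset.range (2 * n), (1 - X ^ (2 * (r + 1)) : ℤ⟦X⟧) =
        (∏ i ∈ Finset.range (2 * n), (1 + X ^ (i + 1))) *
          ∏ i ∈ Finset.range (2 * n), (1 - X ^ (i + 1)) := by
      rw [← Finset.prod_mul_distrib]
      refine Finset.prod_congr rfl fun i _ => ?_
      ring
    rw [h2, h1]
    simp only [mul_add_one, add_assoc, one_add_one_eq_two]
    ring
  rw [h]
  refine pow_dvd_prod_one_sub_pow_sub_one _ _ _ _ fun i hi => ?_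
  have := Finset.mem_Ico.1 hi
  omega

theorem T_strictMono : StrictMono T :=
  strictMono_nat_of_lt_succ fun n => by
    have h := two_mul_T n
    have h' := two_mul_T (n + 1)
    nlinarith

theorem coeff_sum_X_pow_T {n M : ℕ} (h : n < M) :
    coeff n (∑ s ∈ Finset.range M, (X : ℤ⟦X⟧) ^ T s) = chi n := by
  simp only [map_sum, coeff_X_pow, chi]
  split_ifs with hT
  · obtain ⟨m, rfl⟩ := hT
    rw [Finset.sum_eq_single_of_mem m
      (Finset.mem_range.2 ((T_strictMono.le_apply).trans_lt h))]
    · simp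
    · intro b _ hb
      exact if_neg fun e => hb (T_strictMono.injective e.symm)
  · exact Finset.sum_eq_zero fun s _ => if_neg fun e => hT ⟨s, e⟩

/-- The Gauss identity for triangular numbers, in truncated form. -/
theorem coeff_distinctSeries_mul_prod {n L : ℕ} (h : n ≤ 2 * L) :
    coeff n (distinctSeries * ∏ r ∈ Finset.range L, (1 - X ^ (2 * (r + 1)))) = chi n := by
  obtain ⟨M₀, hM₀⟩ := X_pow_dvd_distinctSeries_sub (2 * L + 1)
  have hD := hM₀ (2 * max L M₀) (by omega)
  have hodd := (pow_dvd_pow (X : ℤ⟦X⟧) (by omega : 2 * L + 1 ≤ 2 * max L M₀ + 1)).trans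
    (X_pow_dvd_prod_mul_prod_odd_sub_one (max L M₀))
  have hgauss := (pow_dvd_pow (X : ℤ⟦X⟧) (by omega : 2 * L + 1 ≤ 2 * max L M₀ + 1)).trans
    (pow_dvd_prod_even_sub (X : ℤ⟦X⟧) (max L M₀))
  have htail : (X : ℤ⟦X⟧) ^ (2 * L + 1) ∣
      ∏ r ∈ Finset.Ico L (max L M₀), (1 - X ^ (2 * (r + 1))) - 1 :=
    pow_dvd_prod_one_sub_pow_sub_one _ _ _ _ fun i hi => by
      have := Finset.mem_Ico.1 hi
      omega
  rw [← Finset.prod_range_mul_prod_Ico _ (le_max_left L M₀)] at hgauss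
  set e : ℤ⟦X⟧ := ∏ r ∈ Finset.range L, (1 - X ^ (2 * (r + 1)))
  set t : ℤ⟦X⟧ := ∏ r ∈ Finset.Ico L (max L M₀), (1 - X ^ (2 * (r + 1)))
  set o : ℤ⟦X⟧ := ∏ r ∈ Finset.range (max L M₀), (1 - X ^ (2 * r + 1))
  set d : ℤ⟦X⟧ := ∏ i ∈ Finset.range (2 * max L M₀), (1 + X ^ (i + 1))
  set ψ : ℤ⟦X⟧ := ∑ s ∈ Finset.range (2 * max L M₀ + 1), X ^ T s with hψ
  have key : (X : ℤ⟦X⟧) ^ (2 * L + 1) ∣ distinctSeries * e - ψ := by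
    convert (((hD.mul_right e).add (hgauss.mul_left d)).sub (htail.mul_left (d * e))).add
      (hodd.mul_right ψ) using 1
    ring
  have hc := X_pow_dvd_iff.1 key n (by omega)
  rw [map_sub, sub_eq_zero] at hc
  rw [hc, hψ, coeff_sum_X_pow_T (by omega)]

theorem chi_nonneg (n : ℕ) : 0 ≤ chi n := by
  unfold chi
  split_ifs <;> simp

theorem Q_natCast_pos (n : ℕ) : 0 < Q n := by
  rw [Q, if_pos (Int.natCast_nonneg n), Int.toNat_natCast, Nat.cast_pos, Finset.card_pos]
  refine ⟨Nat.Partition.indiscrete n, ?_⟩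
  simp only [Nat.Partition.distincts, Finset.mem_filter, Finset.mem_univ, true_and]
  rcases eq_or_ne n 0 with rfl | hn
  · simp
  · simp [hn]

theorem coeff_nonneg_of_mul_one_sub_X_pow {f : ℤ⟦X⟧} {N m : ℕ} (hm : 0 < m)
    (h : ∀ n ≤ N, 0 ≤ coeff n (f * (1 - X ^ m))) : ∀ n ≤ N, 0 ≤ coeff n f := by
  intro n
  induction n using Nat.strong_induction_on with
  | _ n ih =>
    intro hn
    have h1 := h n hn
    rw [mul_sub, mul_one, map_sub, coeff_mul_X_pow'] at h1
    split_ifs at h1 with hmn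
    · have := ih (n - m) (by omega) (by omega)
      omega
    · simpa using h1

theorem coeff_nonneg_of_mul_prod (s : Finset ℕ) (N : ℕ) :
    ∀ f : ℤ⟦X⟧, (∀ n ≤ N, 0 ≤ coeff n (f * ∏ r ∈ s, (1 - X ^ (2 * (r + 1))))) →
      ∀ n ≤ N, 0 ≤ coeff n f := by
  induction s using Finset.cons_induction with
  | empty => simp
  | cons a s ha ih =>
    intro f h
    refine coeff_nonneg_of_mul_one_sub_X_pow (by omega : 0 < 2 * (a + 1)) (ih _ ?_)
    simpa only [Finset.prod_cons, mul_assoc] using h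

theorem coeff_distinctSeries_mul_prod_nonneg (s : Finset ℕ) (n : ℕ) :
    0 ≤ coeff n (distinctSeries * ∏ r ∈ s, (1 - X ^ (2 * (r + 1)))) := by
  obtain ⟨M, hM⟩ := s.exists_nat_subset_range
  have hs : s ⊆ Finset.range (max M n) :=
    hM.trans (Finset.range_subset_range.2 (le_max_left M n))
  refine coeff_nonneg_of_mul_prod (Finset.range (max M n) \ s) n _ (fun m hm => ?_) n le_rfl
  rw [mul_assoc, mul_comm (∏ r ∈ s, _), Finset.prod_sdiff hs,
    coeff_distinctSeries_mul_prod (by omega)]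
  exact chi_nonneg m

theorem remainderTerm_X_sq (k n : ℕ) :
    remainderTerm (X ^ 2 : ℤ⟦X⟧) k n = (∏ r ∈ Finset.Ico k (k + n + 1), (1 - X ^ (2 * (r + 1)))) *
      X ^ (2 * (k + 1) * n) := by
  rw [remainderTerm, Finset.prod_Ico_eq_prod_range, mul_comm, show k + n + 1 - k = n + 1 by omega]
  simp only [← pow_mul, mul_assoc]

theorem coeff_distinctSeries_mul_remainderTerm_nonneg (k m n : ℕ) :
    0 ≤ coeff n (distinctSeries * remainderTerm (X ^ 2) k m) := by
  rw [remainderTerm_X_sq, ← mul_assoc, coeff_mul_X_pow']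
  split_ifs
  · exact coeff_distinctSeries_mul_prod_nonneg _ _
  · rfl

theorem coeff_distinctSeries_mul_remainderTerm_pos (k n : ℕ) :
    0 < coeff n (distinctSeries * remainderTerm (X ^ 2) k (n / (2 * (k + 1)))) := by
  rw [remainderTerm_X_sq, ← mul_assoc, coeff_mul_X_pow', if_pos (Nat.mul_div_le _ _),
    ← Nat.mod_eq_sub]
  have hdvd : (X : ℤ⟦X⟧) ^ (2 * (k + 1)) ∣
      ∏ r ∈ Finset.Ico k (k + n / (2 * (k + 1)) + 1), (1 - X ^ (2 * (r + 1))) - 1 :=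
    pow_dvd_prod_one_sub_pow_sub_one _ _ _ _ fun i hi => by
      have := Finset.mem_Ico.1 hi
      omega
  have hc := X_pow_dvd_iff.1 (hdvd.mul_left distinctSeries) _
    (Nat.mod_lt n (by omega : 0 < 2 * (k + 1)))
  rw [mul_sub, mul_one, map_sub, sub_eq_zero] at hc
  rw [hc, distinctSeries, coeff_mk]
  exact Q_natCast_pos _

theorem coeff_distinctSeries_mul_sum_remainderTerm_pos {n L : ℕ} (k : ℕ) (h : n < L) :
    0 < coeff n (distinctSeries * ∑ m ∈ Finset.range L, remainderTerm (X ^ 2) k m) := by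
  rw [Finset.mul_sum, map_sum]
  exact Finset.sum_pos' (fun m _ => coeff_distinctSeries_mul_remainderTerm_nonneg k m n)
    ⟨n / (2 * (k + 1)), Finset.mem_range.2 ((Nat.div_le_self _ _).trans_lt h),
      coeff_distinctSeries_mul_remainderTerm_pos k n⟩

theorem coeff_distinctSeries_mul_X_pow (n m : ℕ) :
    coeff n (distinctSeries * X ^ m) = Q ((n : ℤ) - m) := by
  rw [coeff_mul_X_pow']
  split_ifs with h
  · rw [distinctSeries, coeff_mk, Nat.cast_sub h]
  · rw [Q, if_neg (by omega)]

theorem coeff_distinctSeries_mul_truncated (n k : ℕ) :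
    coeff n (distinctSeries * ∑ j ∈ Finset.range k, (-1) ^ T j * (X ^ 2) ^ G j) =
      ∑ j ∈ Finset.range k, (-1 : ℤ) ^ T j * Q ((n : ℤ) - 2 * (G j : ℤ)) := by
  rw [Finset.mul_sum, map_sum]
  refine Finset.sum_congr rfl fun j _ => ?_
  have hC : ((-1 : ℤ⟦X⟧) ^ T j) = C ((-1 : ℤ) ^ T j) := by simp
  rw [mul_left_comm, hC, coeff_C_mul, ← pow_mul, coeff_distinctSeries_mul_X_pow]
  push_cast
  rfl

theorem truncated_sum_sub_chi (n k : ℕ) :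
    (-1 : ℤ) ^ k * ((∑ j ∈ Finset.range (2 * (k + 1)),
      (-1 : ℤ) ^ T j * Q ((n : ℤ) - 2 * (G j : ℤ))) - chi n) =
      coeff n (distinctSeries * (∑ m ∈ Finset.range (n + 1), remainderTerm (X ^ 2) k m) *
        X ^ (2 * G (2 * (k + 1)))) := by
  have hdvd := (pow_dvd_prod_sub_truncated_pentagonal (X ^ 2 : ℤ⟦X⟧) (n + 1) k).mul_left
    distinctSeries
  simp only [← pow_mul (X : ℤ⟦X⟧) 2 (_ + 1)] at hdvd
  have hc := X_pow_dvd_iff.1 hdvd n (by omega)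
  have hC : ((-1 : ℤ⟦X⟧) ^ (k + 1)) = C ((-1 : ℤ) ^ (k + 1)) := by simp
  rw [mul_sub, map_sub, coeff_distinctSeries_mul_prod (by omega), mul_add, map_add,
    coeff_distinctSeries_mul_truncated, mul_assoc, mul_left_comm, hC, coeff_C_mul,
    ← pow_mul (X : ℤ⟦X⟧) 2 (G _), mul_left_comm, mul_comm (X ^ _)] at hc
  have hs : (-1 : ℤ) ^ k * (-1) ^ k = 1 := by rw [← mul_pow]; simp
  rw [pow_succ] at hc
  set c := coeff n (distinctSeries * (∑ m ∈ Finset.range (n + 1), remainderTerm (X ^ 2) k m) *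
    X ^ (2 * G (2 * (k + 1))))
  linear_combination (-(-1) ^ k) * hc + c * hs

end GeneratingFunction

theorem stmt_0 (n k : ℕ) (hk : 1 ≤ k) :
    0 ≤ (-1 : ℤ) ^ (k - 1) *
        ((∑ j ∈ Finset.range (2 * k), (-1 : ℤ) ^ (T j) * Q ((n : ℤ) - 2 * (G j : ℤ))) - chi n) ∧
    (0 < (-1 : ℤ) ^ (k - 1) *
        ((∑ j ∈ Finset.range (2 * k), (-1 : ℤ) ^ (T j) * Q ((n : ℤ) - 2 * (G j : ℤ))) - chi n) ↔
      2 * G (2 * k) ≤ n) := by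
  obtain ⟨k, rfl⟩ := Nat.exists_eq_add_of_le' hk
  rw [Nat.add_sub_cancel, truncated_sum_sub_chi, coeff_mul_X_pow']
  split_ifs with h
  · have hpos := coeff_distinctSeries_mul_sum_remainderTerm_pos k
      (by omega : n - 2 * G (2 * (k + 1)) < n + 1)
    exact ⟨hpos.le, iff_of_true hpos h⟩
  · exact ⟨le_rfl, iff_of_false (lt_irrefl 0) h⟩
end

section
/- For every positive integer n, the number of pairs (a, j) with a a nonnegative integer and j an integer such that G_a + j² = n (so that each positive square is counted once for j and once for −j) is odd if and only if n is a generalized pentagonal number, i.e. n = G_m for some integer m ≥ 0. -/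
theorem T_succ (n : ℕ) : T (n + 1) = T n + (n + 1) := by
  unfold T
  rw [show (n + 1) * (n + 1 + 1) = n * (n + 1) + (n + 1) * 2 by ring,
    Nat.add_mul_div_right _ _ two_pos]

theorem T_monotone : Monotone T :=
  monotone_nat_of_le_succ fun n => by rw [T_succ]; omega

theorem G_strictMono : StrictMono G := by
  refine strictMono_nat_of_lt_succ fun n => ?_
  have h₁ := T_monotone (Nat.div_le_self n 2)
  have h₂ := T_monotone (Nat.div_le_self (n + 1) 2)
  have h₃ := T_succ n
  unfold G
  rcases Nat.even_or_odd' n with ⟨k, rfl | rfl⟩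
  · rw [show (2 * k + 1) / 2 = 2 * k / 2 by omega] at *
    omega
  · have h₄ := T_succ k
    rw [show (2 * k + 1 + 1) / 2 = k + 1 by omega] at *
    rw [show (2 * k + 1) / 2 = k by omega] at *
    omega

/-- The pairs `(a, j)` with `G a + j ^ 2 = n`. -/
abbrev PentagonalSquarePair (n : ℕ) : Type :=
  {p : ℕ × ℤ // (G p.1 : ℤ) + p.2 ^ 2 = (n : ℤ)}

instance (n : ℕ) : Finite (PentagonalSquarePair n) := by
  refine Set.Finite.to_subtype (Set.Finite.subset
    ((Set.finite_Iic n).prod (Set.finite_Icc (-n : ℤ) n)) ?_)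
  rintro ⟨a, j⟩ (h : (G a : ℤ) + j ^ 2 = n)
  have ha : a ≤ G a := G_strictMono.le_apply
  have hj : (j.natAbs : ℤ) ≤ j ^ 2 := Int.natAbs_le_self_sq j
  simp only [Set.mem_prod, Set.mem_Iic, Set.mem_Icc]
  omega

namespace PentagonalSquarePair

/-- The involution `(a, j) ↦ (a, -j)`. -/
def negSnd (n : ℕ) : PentagonalSquarePair n → PentagonalSquarePair n :=
  fun p => ⟨(p.1.1, -p.1.2), by simpa using p.2⟩

theorem negSnd_involutive {n : ℕ} : Function.Involutive (negSnd n) :=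
  fun p => by simp [negSnd]

theorem mem_fixedPoints_negSnd {n : ℕ} {p : PentagonalSquarePair n} :
    p ∈ Function.fixedPoints (negSnd n) ↔ p.1.2 = 0 := by
  simp [Function.mem_fixedPoints, Function.IsFixedPt, negSnd, Subtype.ext_iff, Prod.ext_iff]
  omega

instance (n : ℕ) : Subsingleton (Function.fixedPoints (negSnd n)) := by
  refine ⟨fun ⟨⟨⟨a, j⟩, h⟩, hj⟩ ⟨⟨⟨b, k⟩, h'⟩, hk⟩ => ?_⟩
  obtain rfl : j = 0 := mem_fixedPoints_negSnd.mp hj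
  obtain rfl : k = 0 := mem_fixedPoints_negSnd.mp hk
  obtain rfl : a = b := G_strictMono.injective (by simp at h h'; omega)
  rfl

theorem nonempty_fixedPoints_negSnd {n : ℕ} :
    Nonempty (Function.fixedPoints (negSnd n)) ↔ ∃ m, n = G m := by
  constructor
  · rintro ⟨⟨⟨⟨a, j⟩, h⟩, hj⟩⟩
    obtain rfl : j = 0 := mem_fixedPoints_negSnd.mp hj
    exact ⟨a, by simp at h; omega⟩
  · rintro ⟨m, rfl⟩
    exact ⟨⟨⟨(m, 0), by simp⟩, mem_fixedPoints_negSnd.mpr rfl⟩⟩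

theorem card_modEq_card_fixedPoints (n : ℕ) :
    Nat.card (PentagonalSquarePair n) ≡ Nat.card (Function.fixedPoints (negSnd n)) [MOD 2] := by
  classical
  have := Fintype.ofFinite (PentagonalSquarePair n)
  have : Fact (Nat.Prime 2) := ⟨Nat.prime_two⟩
  simp only [Nat.card_eq_fintype_card]
  have hf : (show Function.End (PentagonalSquarePair n) from negSnd n) ^ 2 ^ 1 = 1 := by
    rw [pow_one, pow_two]
    exact negSnd_involutive.comp_self
  convert Equiv.Perm.card_fixedPoints_modEq hf

end PentagonalSquarePair

theorem stmt_9 (n : ℕ) (hn : 0 < n) :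
    Odd (Nat.card {p : ℕ × ℤ // (G p.1 : ℤ) + p.2 ^ 2 = (n : ℤ)}) ↔ ∃ m, n = G m := by
  rw [Nat.odd_iff, PentagonalSquarePair.card_modEq_card_fixedPoints n,
    ← PentagonalSquarePair.nonempty_fixedPoints_negSnd]
  rcases isEmpty_or_nonempty (Function.fixedPoints (PentagonalSquarePair.negSnd n)) with h | h
  · simpa only [not_nonempty_iff.mpr h, iff_false] using by rw [Nat.card_of_isEmpty]; decide
  · simpa only [h, iff_true] using congrArg (· % 2) Nat.card_unique
end

section
/- For every positive integer n, the number of ordered pairs (a, b) of nonnegative integers such that G_a + T_b = n is odd if and only if n = 4G_m for some integer m ≥ 0 (i.e., n is four times a generalized pentagonal number). -/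
lemma eight_mul_T_add_one (n : ℕ) : 8 * T n + 1 = (2 * n + 1) ^ 2 := by
  have h : 2 * T n = n * (n + 1) := Nat.mul_div_cancel' (Nat.even_mul_succ_self n).two_dvd
  linear_combination 4 * h

lemma twentyFour_mul_G_add_one (n : ℕ) : 24 * G n + 1 = (3 * n + 1 + n % 2) ^ 2 := by
  have h₁ := eight_mul_T_add_one n
  have h₂ := eight_mul_T_add_one (n / 2)
  have h₃ : T (n / 2) ≤ T n := by
    have : (2 * (n / 2) + 1) ^ 2 ≤ (2 * n + 1) ^ 2 := by gcongr; omega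
    omega
  have h₄ : G n + T (n / 2) = T n := Nat.sub_add_cancel h₃
  obtain ⟨k, r, hk, hr, hn⟩ : ∃ k r, n / 2 = k ∧ n % 2 = r ∧ n = 2 * k + r :=
    ⟨_, _, rfl, rfl, by omega⟩
  have hr' : r = 0 ∨ r = 1 := by omega
  rw [hk] at h₂ h₄
  rw [hr]
  zify at h₁ h₂ h₄ hn ⊢
  rcases hr' with rfl | rfl <;> push_cast at hn ⊢ <;> rw [hn] at h₁ ⊢ <;>
    linear_combination 24 * h₄ + 3 * h₁ - 3 * h₂

/-- The involution `(x, y) ↦ (|x - 3εy| / 2, |x + εy| / 2)` on pairs of odd numbers, where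
`ε = ±1` satisfies `x ≡ εy [MOD 4]`. It preserves the form `x ^ 2 + 3 * y ^ 2`. -/
def oddPairFlip (p : ℕ × ℕ) : ℕ × ℕ :=
  if p.1 % 4 = p.2 % 4 then (((p.1 : ℤ) - 3 * p.2).natAbs / 2, (p.1 + p.2) / 2)
  else ((p.1 + 3 * p.2) / 2, ((p.1 : ℤ) - p.2).natAbs / 2)

lemma oddPairFlip_odd {p : ℕ × ℕ} (h₁ : p.1 % 2 = 1) (h₂ : p.2 % 2 = 1) :
    (oddPairFlip p).1 % 2 = 1 ∧ (oddPairFlip p).2 % 2 = 1 := by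
  unfold oddPairFlip
  split_ifs <;> constructor <;> dsimp only <;> omega

lemma oddPairFlip_oddPairFlip {p : ℕ × ℕ} (h₁ : p.1 % 2 = 1) (h₂ : p.2 % 2 = 1) :
    oddPairFlip (oddPairFlip p) = p := by
  obtain ⟨x, y⟩ := p
  simp only [oddPairFlip] at *
  split_ifs <;> simp only [Prod.mk.injEq] at * <;> constructor <;> omega

lemma oddPairFlip_form {p : ℕ × ℕ} (h₁ : p.1 % 2 = 1) (h₂ : p.2 % 2 = 1) :
    (oddPairFlip p).1 ^ 2 + 3 * (oddPairFlip p).2 ^ 2 = p.1 ^ 2 + 3 * p.2 ^ 2 := by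
  obtain ⟨x, y⟩ := p
  have key (u v : ℕ) (z : ℤ) (hz : z ^ 2 = y ^ 2) (hu : 2 * u = ((x : ℤ) - 3 * z).natAbs)
      (hv : 2 * v = ((x : ℤ) + z).natAbs) : u ^ 2 + 3 * v ^ 2 = x ^ 2 + 3 * y ^ 2 := by
    have hu' := Int.natAbs_sq ((x : ℤ) - 3 * z)
    have hv' := Int.natAbs_sq ((x : ℤ) + z)
    rw [← hu] at hu'
    rw [← hv] at hv'
    zify
    push_cast at hu' hv'
    linarith
  simp only [oddPairFlip] at *
  split_ifs
  · exact key _ _ y rfl (by omega) (by omega)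
  · exact key _ _ (-y) (neg_sq _) (by omega) (by omega)

lemma oddPairFlip_eq_self {p : ℕ × ℕ} (h₁ : p.1 % 2 = 1) (h₂ : p.2 % 2 = 1)
    (h₃ : p.1 % 3 ≠ 0) (h : oddPairFlip p = p) : p.1 = p.2 := by
  obtain ⟨x, y⟩ := p
  simp only [oddPairFlip] at *
  split_ifs at h <;> simp only [Prod.mk.injEq] at h <;> omega

/-- The pairs of odd numbers with `x ^ 2 + 3 * y ^ 2 = 24 * n + 4`. -/
def oddPairs (n : ℕ) : Finset (ℕ × ℕ) :=
  {p ∈ Finset.range (24 * n + 5) ×ˢ Finset.range (24 * n + 5) |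
    p.1 % 2 = 1 ∧ p.2 % 2 = 1 ∧ p.1 ^ 2 + 3 * p.2 ^ 2 = 24 * n + 4}

lemma mem_oddPairs {n : ℕ} {p : ℕ × ℕ} : p ∈ oddPairs n ↔
    p.1 % 2 = 1 ∧ p.2 % 2 = 1 ∧ p.1 ^ 2 + 3 * p.2 ^ 2 = 24 * n + 4 := by
  simp only [oddPairs, Finset.mem_filter, Finset.mem_product, Finset.mem_range,
    and_iff_right_iff_imp]
  rintro ⟨-, -, h⟩
  constructor <;> nlinarith [Nat.le_self_pow two_ne_zero p.1, Nat.le_self_pow two_ne_zero p.2]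

lemma mod_three_ne_zero_of_sq_add {x y n : ℕ} (h : x ^ 2 + 3 * y = 24 * n + 4) :
    x % 3 ≠ 0 := by
  intro hx
  obtain ⟨k, rfl⟩ := Nat.dvd_of_mod_eq_zero hx
  rw [mul_pow] at h
  omega

lemma card_pairs_eq_card_oddPairs (n : ℕ) :
    Nat.card {p : ℕ × ℕ // G p.1 + T p.2 = n} = (oddPairs n).card := by
  let f : ℕ × ℕ → ℕ × ℕ := fun p ↦ (3 * p.1 + 1 + p.1 % 2, 2 * p.2 + 1)
  have hf : f.Injective := by
    rintro ⟨a, b⟩ ⟨c, d⟩ h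
    simp only [f, Prod.mk.injEq] at h ⊢
    omega
  have himage : f '' {p | G p.1 + T p.2 = n} = oddPairs n := by
    ext ⟨x, y⟩
    simp only [Set.mem_image, Set.mem_ofPred_eq, SetLike.mem_coe, mem_oddPairs]
    constructor
    · rintro ⟨⟨a, b⟩, h, he⟩
      simp only [f, Prod.mk.injEq] at h he
      obtain ⟨rfl, rfl⟩ := he
      have := twentyFour_mul_G_add_one a
      have := eight_mul_T_add_one b
      omega
    · rintro ⟨hx, hy, h⟩
      have hx₃ := mod_three_ne_zero_of_sq_add h
      have hx' : 3 * (x / 3) + 1 + x / 3 % 2 = x := by omega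
      have hy' : 2 * (y / 2) + 1 = y := by omega
      have hG := twentyFour_mul_G_add_one (x / 3)
      have hT := eight_mul_T_add_one (y / 2)
      rw [hx'] at hG
      rw [hy'] at hT
      exact ⟨(x / 3, y / 2), by dsimp only; omega, Prod.ext hx' hy'⟩
  rw [← Set.ncard_coe_finset, ← himage, Set.ncard_image_of_injective _ hf]
  rfl

lemma even_card_oddPairs_ne (n : ℕ) : Even {p ∈ oddPairs n | p.1 ≠ p.2}.card := by
  rw [← ZMod.natCast_eq_zero_iff_even, Finset.card_eq_sum_ones, Nat.cast_sum]
  refine Finset.sum_involution (fun p _ ↦ oddPairFlip p) (fun _ _ ↦ by decide) ?_ ?_ ?_ <;>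
    intro p hp <;> obtain ⟨hp, hne⟩ := Finset.mem_filter.1 hp <;>
    obtain ⟨h₁, h₂, h⟩ := mem_oddPairs.1 hp
  · exact fun _ he ↦ hne (oddPairFlip_eq_self h₁ h₂ (mod_three_ne_zero_of_sq_add h) he)
  · obtain ⟨h₁', h₂'⟩ := oddPairFlip_odd h₁ h₂
    have h' := (oddPairFlip_form h₁ h₂).trans h
    refine Finset.mem_filter.2 ⟨mem_oddPairs.2 ⟨h₁', h₂', h'⟩, fun he ↦ hne ?_⟩
    have hfix : oddPairFlip (oddPairFlip p) = oddPairFlip p := by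
      generalize oddPairFlip p = q at *
      obtain ⟨x, y⟩ := q
      simp only [oddPairFlip] at *
      split_ifs <;> simp only [Prod.mk.injEq] <;> omega
    rw [oddPairFlip_oddPairFlip h₁ h₂] at hfix
    rwa [← hfix] at he
  · exact oddPairFlip_oddPairFlip h₁ h₂

lemma odd_card_oddPairs_eq (n : ℕ) :
    Odd {p ∈ oddPairs n | p.1 = p.2}.card ↔ ∃ m, n = 4 * G m := by
  have hle : {p ∈ oddPairs n | p.1 = p.2}.card ≤ 1 := by
    refine Finset.card_le_one.2 ?_
    rintro ⟨a, b⟩ hp ⟨c, d⟩ hq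
    simp only [Finset.mem_filter, mem_oddPairs] at hp hq
    obtain ⟨⟨-, -, hp⟩, rfl⟩ := hp
    obtain ⟨⟨-, -, hq⟩, rfl⟩ := hq
    have : a = c := Nat.pow_left_injective two_ne_zero (by dsimp only; omega)
    rw [this]
  have hodd : Odd {p ∈ oddPairs n | p.1 = p.2}.card ↔
      0 < {p ∈ oddPairs n | p.1 = p.2}.card := by
    rw [Nat.odd_iff]
    omega
  rw [hodd, Finset.card_pos]
  constructor
  · rintro ⟨⟨x, y⟩, hp⟩
    simp only [Finset.mem_filter, mem_oddPairs] at hp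
    obtain ⟨⟨hx, -, h⟩, rfl⟩ := hp
    have hx₃ := mod_three_ne_zero_of_sq_add h
    have hG := twentyFour_mul_G_add_one (x / 3)
    rw [show 3 * (x / 3) + 1 + x / 3 % 2 = x by omega] at hG
    exact ⟨x / 3, by omega⟩
  · rintro ⟨m, rfl⟩
    have hG := twentyFour_mul_G_add_one m
    refine ⟨(3 * m + 1 + m % 2, 3 * m + 1 + m % 2), ?_⟩
    simp only [Finset.mem_filter, mem_oddPairs, and_true]
    omega

theorem stmt_16 (n : ℕ) (hn : 0 < n) :
    Odd (Nat.card {p : ℕ × ℕ // G p.1 + T p.2 = n}) ↔ ∃ m, n = 4 * G m := by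
  rw [card_pairs_eq_card_oddPairs,
    ← Finset.card_filter_add_card_filter_not (s := oddPairs n) (fun p ↦ p.1 = p.2),
    Nat.odd_add, iff_true_right (even_card_oddPairs_ne n), odd_card_oddPairs_eq]
end
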